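/- Let G₁ and G₂ be nontrivial torsion-free groups. Then G₁ and G₂ are geometrically PUnit-equivalent, i.e. equivalent with respect to a one-element set of variables: for every normal subgroup N of FreeGroup PUnit, the G₁-closure of N equals the G₂-closure of N. -/

import Mathlib

/-- The `G`-closure of a normal subgroup `N` of `W`: the intersection of the kernels of all
homomorphisms `μ : W →* G` with `N ≤ ker μ` (over an empty family this is all of `W`). -/
def gClosure (G : Type*) [Group G] {W : Type*} [Group W] (N : Subgroup W) : Subgroup W :=
  ⨅ μ : {μ : W →* G // N ≤ MonoidHom.ker μ}, MonoidHom.ker μ.1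

/-- Every element of the free group on one generator is a power of the generator. -/
lemma FreeGroup.exists_eq_of_zpow (w : FreeGroup PUnit) :
    ∃ n : ℤ, w = FreeGroup.of PUnit.unit ^ n := by
  induction w using FreeGroup.induction_on with
  | C1 => exact ⟨0, by simp⟩
  | of x => exact ⟨1, by simp⟩
  | inv_of x _ => exact ⟨-1, by simp⟩
  | mul x y hx hy =>
    obtain ⟨m, rfl⟩ := hx
    obtain ⟨n, rfl⟩ := hy
    exact ⟨m + n, (zpow_add _ m n).symm⟩

lemma mem_gClosure {G W : Type*} [Group G] [Group W] {N : Subgroup W} {w : W} :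
    w ∈ gClosure G N ↔ ∀ μ : W →* G, N ≤ μ.ker → μ w = 1 := by
  simp [gClosure, Subgroup.mem_iInf, MonoidHom.mem_ker]

lemma eq_one_of_zpow_eq_one {G : Type*} [Group G] (h : ∀ g : G, IsOfFinOrder g → g = 1)
    {g : G} {n : ℤ} (hn : n ≠ 0) (hg : g ^ n = 1) : g = 1 :=
  h g (isOfFinOrder_iff_zpow_eq_one.mpr ⟨n, hn, hg⟩)

/-- A nontrivial torsion-free group separates the points of the free group on one generator. -/
lemma gClosure_bot_punit {G : Type*} [Group G] [Nontrivial G]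
    (h : ∀ g : G, IsOfFinOrder g → g = 1) :
    gClosure G (⊥ : Subgroup (FreeGroup PUnit)) = ⊥ := by
  refine (Subgroup.eq_bot_iff_forall _).mpr fun w hw => ?_
  obtain ⟨g, hg⟩ := exists_ne (1 : G)
  obtain ⟨n, rfl⟩ := FreeGroup.exists_eq_of_zpow w
  have hgn : g ^ n = 1 := by
    simpa using mem_gClosure.mp hw (FreeGroup.lift fun _ => g) bot_le
  by_cases hn : n = 0
  · simp [hn]
  · exact absurd (eq_one_of_zpow_eq_one h hn hgn) hg

/-- In a torsion-free group, a nontrivial equation in one variable has only the trivial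
solution. -/
lemma gClosure_punit_of_ne_bot {G : Type*} [Group G]
    (h : ∀ g : G, IsOfFinOrder g → g = 1) {N : Subgroup (FreeGroup PUnit)} (hN : N ≠ ⊥) :
    gClosure G N = ⊤ := by
  obtain ⟨w, hwN, hw⟩ := N.bot_or_exists_ne_one.resolve_left hN
  obtain ⟨n, rfl⟩ := FreeGroup.exists_eq_of_zpow w
  have hn : n ≠ 0 := by
    rintro rfl
    exact hw (zpow_zero _)
  refine (Subgroup.eq_top_iff' _).mpr fun v => mem_gClosure.mpr fun μ hμ => ?_
  have hμn : μ (FreeGroup.of PUnit.unit) ^ n = 1 := by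
    simpa [MonoidHom.mem_ker] using hμ hwN
  obtain ⟨m, rfl⟩ := FreeGroup.exists_eq_of_zpow v
  rw [map_zpow, eq_one_of_zpow_eq_one h hn hμn, one_zpow]

/-- §3.8: any two nontrivial torsion-free groups are geometrically equivalent with respect to
a one-element set of variables. -/
theorem geomEquiv_punit_of_torsionFree {G₁ G₂ : Type*} [Group G₁] [Group G₂]
    [Nontrivial G₁] [Nontrivial G₂]
    (h₁ : ∀ g : G₁, IsOfFinOrder g → g = 1) (h₂ : ∀ g : G₂, IsOfFinOrder g → g = 1) :
    ∀ N : Subgroup (FreeGroup PUnit), N.Normal → gClosure G₁ N = gClosure G₂ N := by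
  intro N _
  by_cases hN : N = ⊥
  · rw [hN, gClosure_bot_punit h₁, gClosure_bot_punit h₂]
  · rw [gClosure_punit_of_ne_bot h₁ hN, gClosure_punit_of_ne_bot h₂ hN]
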